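/- Let G be a finite group in which every real-valued irreducible character has Frobenius–Schur indicator 1. Then the sequence s(n)/|G|ⁿ is non-increasing in n, where s(n) = |{(g₁,…,gₙ) ∈ Gⁿ : g₁²⋯gₙ² = 1}|. -/

import Mathlib

open Module Representation

section IrreducibleRepresentations

variable {G k V : Type*} [Group G] [Fintype G] [Field k] [AddCommGroup V] [Module k V]

/-- The intertwining map `ψ ↦ ∑ g, ψ (ρ g w) • ρ g v` from the dual of a representation to the
representation. -/
def Representation.dualAverage (ρ : Representation k G V) (w v : V) :
    IntertwiningMap ρ.dual ρ where
  toLinearMap := ∑ g : G, (Dual.eval k V (ρ g w)).smulRight (ρ g v)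
  isIntertwining' h := by
    ext ψ
    simp only [LinearMap.comp_apply, LinearMap.sum_apply, LinearMap.smulRight_apply,
      Dual.eval_apply, map_sum, map_smul]
    refine (Fintype.sum_equiv (Equiv.mulLeft h) _ _ fun g => ?_).symm
    simp [← Module.End.mul_apply, ← map_mul, Representation.dual_apply, Module.Dual.transpose_apply]

theorem Representation.dualAverage_apply (ρ : Representation k G V) (w v : V) (ψ : Dual k V) :
    ρ.dualAverage w v ψ = ∑ g : G, ψ (ρ g w) • ρ g v := by
  change (∑ g : G, (Dual.eval k V (ρ g w)).smulRight (ρ g v)) ψ = _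
  simp

variable [FiniteDimensional k V]

/-- The Frobenius–Schur sum of an irreducible representation vanishes when the character is not
self-dual. -/
theorem Representation.sum_character_sq_eq_zero (ρ : Representation k G V) [IsIrreducible ρ]
    (hρ : ρ.character ≠ ρ.dual.character) : ∑ g : G, ρ.character (g ^ 2) = 0 := by
  have key (w v : V) : ρ.dualAverage w v = 0 := by
    refine (IsIrreducible.surjective_or_eq_zero (ρ.dualAverage w v)).resolve_left fun hs => ?_
    have hinj : Function.Injective (ρ.dualAverage w v).toLinearMap :=
      (LinearMap.injective_iff_surjective_of_finrank_eq_finrank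
        Subspace.dual_finrank_eq).2 hs
    exact hρ (char_iso ((ρ.dualAverage w v).ofBijective ⟨hinj, hs⟩)).symm
  let b := finBasis k V
  have key' (i j) : ∑ g : G, b.coord i (ρ g (b j)) * b.coord j (ρ g (b i)) = 0 := by
    have h := congrArg (b.coord j) (ρ.dualAverage_apply (b j) (b i) (b.coord i))
    rw [key] at h
    simpa using h.symm
  calc ∑ g : G, ρ.character (g ^ 2)
      = ∑ g : G, ∑ i, ∑ j, b.coord i (ρ g (b j)) * b.coord j (ρ g (b i)) := by
        refine Finset.sum_congr rfl fun g _ => ?_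
        rw [Representation.character, pow_two, map_mul, LinearMap.trace_eq_matrix_trace k b,
          LinearMap.toMatrix_mul, Matrix.trace]
        simp [Matrix.mul_apply, LinearMap.toMatrix_apply]
    _ = 0 := by
        rw [Finset.sum_comm]
        refine Finset.sum_eq_zero fun i _ => ?_
        rw [Finset.sum_comm]
        exact Finset.sum_eq_zero fun j _ => key' i j

end IrreducibleRepresentations

theorem FDRep.simple_of_isIrreducible {G V : Type} [Group G] [Fintype G] [AddCommGroup V]
    [Module ℂ V] [FiniteDimensional ℂ V] (ρ : Representation ℂ G V) [IsIrreducible ρ] :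
    CategoryTheory.Simple (FDRep.of ρ) := by
  have : Invertible (Nat.card G : ℂ) := invertibleOfNonzero (NeZero.ne _)
  rw [FDRep.simple_iff_char_is_norm_one]
  have h := Representation.char_orthonormal ρ ρ
  rw [if_pos ⟨Representation.Equiv.refl ρ⟩, inv_mul_eq_one₀ (NeZero.ne _)] at h
  exact h.symm

theorem Subrepresentation.exists_isIrreducible {G k V : Type*} [Group G] [Field k]
    [AddCommGroup V] [Module k V] [FiniteDimensional k V] {ρ : Representation k G V}
    (σ : Subrepresentation ρ) (hσ : σ ≠ ⊥) :
    ∃ τ ≤ σ, τ ≠ ⊥ ∧ IsIrreducible τ.toRepresentation := by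
  have hwf : WellFounded fun τ₁ τ₂ : Subrepresentation ρ => τ₁.toSubmodule < τ₂.toSubmodule :=
    InvImage.wf _ wellFounded_lt
  obtain ⟨τ, ⟨hτσ, hτ⟩, hmin⟩ := hwf.has_min {τ | τ ≤ σ ∧ τ ≠ ⊥} ⟨σ, le_rfl, hσ⟩
  refine ⟨τ, hτσ, hτ, @IsSimpleOrder.mk _ _ _ ⟨⊥, ⊤, fun h => hτ ?_⟩ fun κ => ?_⟩
  · apply Subrepresentation.toSubmodule_injective
    have h' : (⊥ : Submodule k τ.toSubmodule) = ⊤ := congrArg Subrepresentation.toSubmodule h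
    have := congrArg (Submodule.map τ.toSubmodule.subtype) h'
    rw [Submodule.map_bot, Submodule.map_subtype_top] at this
    exact this.symm
  · let κ' : Subrepresentation ρ :=
      { toSubmodule := κ.toSubmodule.map τ.toSubmodule.subtype
        apply_mem_toSubmodule := by
          rintro g _ ⟨v, hv, rfl⟩
          exact ⟨_, κ.apply_mem_toSubmodule g hv, rfl⟩ }
    have hκτ : κ'.toSubmodule ≤ τ.toSubmodule := Submodule.map_subtype_le _ _
    have hinj : Function.Injective (Submodule.map τ.toSubmodule.subtype) :=
      Submodule.map_injective_of_injective τ.toSubmodule.injective_subtype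
    by_cases hκ : κ' = ⊥
    · refine .inl (Subrepresentation.toSubmodule_injective (hinj ?_))
      exact (congrArg Subrepresentation.toSubmodule hκ).trans (Submodule.map_bot _).symm
    · refine .inr (Subrepresentation.toSubmodule_injective (hinj ?_))
      have heq : κ'.toSubmodule = τ.toSubmodule :=
        hκτ.eq_of_not_lt (hmin κ' ⟨le_trans hκτ hτσ, hκ⟩)
      exact heq.trans (Submodule.map_subtype_top _).symm

section UnitaryRepresentations

open ComplexConjugate

variable {G E : Type*} [Group G] [NormedAddCommGroup E] [InnerProductSpace ℂ E]
  (ρ : Representation ℂ G E)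

theorem Representation.inner_apply_left_of_unitary
    (hρ : ∀ g x y, inner ℂ (ρ g x) (ρ g y) = inner ℂ x y) (g : G) (x y : E) :
    inner ℂ (ρ g x) y = inner ℂ x (ρ g⁻¹ y) := by
  rw [← hρ g x (ρ g⁻¹ y), ρ.self_inv_apply]

variable [FiniteDimensional ℂ E]

theorem Representation.character_inv_of_unitary
    (hρ : ∀ g x y, inner ℂ (ρ g x) (ρ g y) = inner ℂ x y) (g : G) :
    ρ.character g⁻¹ = conj (ρ.character g) := by
  simp only [Representation.character,
    LinearMap.trace_eq_sum_inner _ (stdOrthonormalBasis ℂ E), map_sum, inner_conj_symm,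
    ρ.inner_apply_left_of_unitary hρ]

end UnitaryRepresentations

section SquareSum

variable {G : Type*} [Group G] [Fintype G]

/-- The operator by which `∑ g, g ^ 2` acts in a representation. -/
def Representation.squareSum {k V : Type*} [Field k] [AddCommGroup V] [Module k V]
    (ρ : Representation k G V) : V →ₗ[k] V :=
  ∑ g : G, ρ (g ^ 2)

theorem Representation.squareSum_comm {k V : Type*} [Field k] [AddCommGroup V] [Module k V]
    (ρ : Representation k G V) (h : G) : ρ h * ρ.squareSum = ρ.squareSum * ρ h := by
  simp only [Representation.squareSum, Finset.mul_sum, Finset.sum_mul, ← map_mul]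
  refine Fintype.sum_equiv (MulAut.conj h).toEquiv _ _ fun g => ?_
  simp [pow_two, mul_assoc]

theorem Representation.squareSum_pow {k V : Type*} [Field k] [AddCommGroup V] [Module k V]
    (ρ : Representation k G V) (n : ℕ) : ρ.squareSum ^ n =
      ∑ v : Fin n → G, ρ ((List.ofFn v).map fun g => g ^ 2).prod := by
  induction n with
  | zero => simp
  | succ n ih =>
    rw [pow_succ', ih, Representation.squareSum, Finset.sum_mul_sum, ← Fintype.sum_prod_type']
    refine Fintype.sum_equiv (Fin.consEquiv fun _ => G) _ _ fun p => ?_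
    simp [Fin.consEquiv, List.ofFn_succ]

variable {E : Type*} [NormedAddCommGroup E] [InnerProductSpace ℂ E] (ρ : Representation ℂ G E)

theorem Representation.squareSum_isSymmetric
    (hρ : ∀ g x y, inner ℂ (ρ g x) (ρ g y) = inner ℂ x y) : ρ.squareSum.IsSymmetric := by
  intro x y
  simp only [Representation.squareSum, LinearMap.sum_apply, sum_inner, inner_sum,
    ρ.inner_apply_left_of_unitary hρ]
  exact Fintype.sum_equiv (Equiv.inv G) _ _ fun g => by simp

theorem Representation.norm_squareSum_apply_le
    (hρ : ∀ g x y, inner ℂ (ρ g x) (ρ g y) = inner ℂ x y) (x : E) :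
    ‖ρ.squareSum x‖ ≤ Fintype.card G * ‖x‖ := by
  have hn (g : G) : ‖ρ g x‖ = ‖x‖ := by
    rw [@norm_eq_sqrt_re_inner ℂ, hρ, ← @norm_eq_sqrt_re_inner ℂ]
  rw [Representation.squareSum, LinearMap.sum_apply]
  exact (norm_sum_le _ _).trans_eq (by simp only [hn]; simp)

end SquareSum

theorem Representation.eigenvalue_squareSum_nonneg {G E : Type} [Group G] [Fintype G]
    (h : ∀ V : FDRep ℂ G, CategoryTheory.Simple V →
      (∀ g : G, ∃ r : ℝ, V.character g = (r : ℂ)) →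
      (Fintype.card G : ℂ)⁻¹ * ∑ g : G, V.character (g ^ 2) = 1)
    [NormedAddCommGroup E] [InnerProductSpace ℂ E] [FiniteDimensional ℂ E]
    (ρ : Representation ℂ G E) (hρ : ∀ g x y, inner ℂ (ρ g x) (ρ g y) = inner ℂ x y)
    {μ : ℝ} (hμ : End.HasEigenvalue ρ.squareSum (μ : ℂ)) : 0 ≤ μ := by
  let σ : Subrepresentation ρ :=
    { toSubmodule := End.eigenspace ρ.squareSum (μ : ℂ)
      apply_mem_toSubmodule := fun g v hv => by
        rw [End.mem_eigenspace_iff] at hv ⊢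
        rw [← Module.End.mul_apply, ← ρ.squareSum_comm, Module.End.mul_apply, hv, map_smul] }
  have hσ : σ ≠ ⊥ := fun h0 => hμ (congrArg Subrepresentation.toSubmodule h0)
  obtain ⟨τ, hτσ, hτ0, hτ⟩ := σ.exists_isIrreducible hσ
  set π := τ.toRepresentation with hπ
  have hπu : ∀ g x y, inner ℂ (π g x) (π g y) = inner ℂ x y := fun g x y => hρ g x y
  have htr : ∑ g : G, π.character (g ^ 2) = μ * (finrank ℂ τ.toSubmodule : ℂ) := by
    have hz : π.squareSum = (μ : ℂ) • LinearMap.id := by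
      ext v
      have hv := End.mem_eigenspace_iff.1 (hτσ v.2)
      simpa [Representation.squareSum, hπ, Subrepresentation.toRepresentation] using hv
    have := congrArg (LinearMap.trace ℂ _) hz
    simpa [Representation.squareSum, Representation.character] using this
  by_cases hreal : ∀ g : G, ∃ r : ℝ, π.character g = (r : ℂ)
  · have h1 := h (FDRep.of π) (FDRep.simple_of_isIrreducible π) hreal
    have h2 : ∑ g : G, π.character (g ^ 2) = Fintype.card G :=
      ((inv_mul_eq_one₀ (by simp)).1 h1).symm
    rw [htr] at h2
    have h3 : μ * (finrank ℂ τ.toSubmodule : ℝ) = Fintype.card G := by exact_mod_cast h2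
    by_contra! hlt
    have h4 : (0 : ℝ) < Fintype.card G := by exact_mod_cast Fintype.card_pos
    nlinarith [(Nat.cast_nonneg (finrank ℂ τ.toSubmodule) : (0 : ℝ) ≤ _)]
  · have h1 : ∑ g : G, π.character (g ^ 2) = 0 := by
      refine π.sum_character_sq_eq_zero fun hd => hreal fun g => ?_
      have h2 := congrFun hd g
      rw [char_dual, π.character_inv_of_unitary hπu] at h2
      exact Complex.conj_eq_iff_real.1 h2.symm
    rw [htr] at h1
    have hpos : finrank ℂ τ.toSubmodule ≠ 0 := fun h0 =>
      hτ0 (Subrepresentation.toSubmodule_injective (Submodule.finrank_eq_zero.1 h0))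
    have : μ = 0 := by simpa [hpos] using h1
    exact this.ge

theorem LinearMap.IsSymmetric.re_inner_pow_succ_le {𝕜 E : Type*} [RCLike 𝕜]
    [NormedAddCommGroup E] [InnerProductSpace 𝕜 E] [FiniteDimensional 𝕜 E] {T : E →ₗ[𝕜] E}
    (hT : T.IsSymmetric) {C : ℝ} (hC : ∀ μ : ℝ, End.HasEigenvalue T (μ : 𝕜) → 0 ≤ μ ∧ μ ≤ C)
    (n : ℕ) (x : E) :
    RCLike.re (inner 𝕜 x ((T ^ (n + 1)) x)) ≤ C * RCLike.re (inner 𝕜 x ((T ^ n) x)) := by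
  let b := hT.eigenvectorBasis rfl
  have hpow (m : ℕ) : RCLike.re (inner 𝕜 x ((T ^ m) x)) =
      ∑ i, hT.eigenvalues rfl i ^ m * ‖inner 𝕜 x (b i)‖ ^ 2 := by
    have hb (i) : (T ^ m) (b i) = ((hT.eigenvalues rfl i ^ m : ℝ) : 𝕜) • b i := by
      induction m with
      | zero => simp
      | succ m ih =>
        rw [pow_succ', Module.End.mul_apply, ih, map_smul, hT.apply_eigenvectorBasis, smul_smul]
        push_cast
        rw [pow_succ]
    rw [← b.sum_inner_mul_inner, map_sum]
    refine Finset.sum_congr rfl fun i _ => ?_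
    rw [← hT.pow m, hb, inner_smul_left, RCLike.conj_ofReal, mul_left_comm,
      ← inner_conj_symm (b i) x, RCLike.mul_conj]
    norm_cast
  rw [hpow, hpow, Finset.mul_sum]
  refine Finset.sum_le_sum fun i _ => ?_
  obtain ⟨h0, h1⟩ := hC _ (hT.hasEigenvalue_eigenvalues rfl i)
  rw [← mul_assoc, pow_succ']
  gcongr

section RegularRepresentation

variable (G : Type*) [Group G] [Fintype G]

/-- The left regular representation on the Euclidean space of functions on a finite group. -/
noncomputable def euclideanRegular : Representation ℂ G (EuclideanSpace ℂ G) where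
  toFun g := (LinearIsometryEquiv.piLpCongrLeft 2 ℂ ℂ (Equiv.mulLeft g)).toLinearEquiv.toLinearMap
  map_one' := by
    ext x i
    exact congrArg x (by simp : (1 : G)⁻¹ * i = i)
  map_mul' g h := by
    ext x i
    exact congrArg x (by simp [mul_assoc] : (g * h)⁻¹ * i = h⁻¹ * (g⁻¹ * i))

theorem inner_euclideanRegular (g : G) (x y : EuclideanSpace ℂ G) :
    inner ℂ (euclideanRegular G g x) (euclideanRegular G g y) = inner ℂ x y :=
  LinearIsometryEquiv.inner_map_map _ x y

open Classical in
theorem re_inner_squareSum_euclideanRegular_pow (n : ℕ) :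
    RCLike.re (inner ℂ (EuclideanSpace.single (1 : G) (1 : ℂ))
      (((euclideanRegular G).squareSum ^ n) (EuclideanSpace.single 1 1))) =
      Nat.card {v : Fin n → G // ((List.ofFn v).map fun g => g ^ 2).prod = 1} := by
  have hs (g : G) : euclideanRegular G g (EuclideanSpace.single 1 1) =
      EuclideanSpace.single g 1 :=
    (EuclideanSpace.piLpCongrLeft_single (Equiv.mulLeft g) 1 (1 : ℂ)).trans (by simp)
  rw [Representation.squareSum_pow, LinearMap.sum_apply, inner_sum, Nat.card_eq_fintype_card,
    Fintype.card_subtype, Finset.card_filter]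
  simp [hs, apply_ite, EuclideanSpace.inner_single_left, eq_comm]

end RegularRepresentation

/-- If every real-valued irreducible character of `G` has Frobenius–Schur indicator `1`,
then `s(n)/|G|ⁿ` is non-increasing in `n`. -/
theorem stmt_11 {G : Type} [Group G] [Fintype G]
    (h : ∀ V : FDRep ℂ G, CategoryTheory.Simple V →
      (∀ g : G, ∃ r : ℝ, V.character g = (r : ℂ)) →
      (Fintype.card G : ℂ)⁻¹ * ∑ g : G, V.character (g ^ 2) = 1)
    (n : ℕ) (hn : 1 ≤ n) :
    Nat.card {v : Fin (n + 1) → G // ((List.ofFn v).map fun g => g ^ 2).prod = 1} ≤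
      Nat.card {v : Fin n → G // ((List.ofFn v).map fun g => g ^ 2).prod = 1} * Fintype.card G := by
  classical
  have hC (μ : ℝ) (hμ : End.HasEigenvalue (euclideanRegular G).squareSum (μ : ℂ)) :
      0 ≤ μ ∧ μ ≤ Fintype.card G := by
    refine ⟨eigenvalue_squareSum_nonneg h _ (inner_euclideanRegular G) hμ, ?_⟩
    obtain ⟨v, hv⟩ := hμ.exists_hasEigenvector
    have hle := (euclideanRegular G).norm_squareSum_apply_le (inner_euclideanRegular G) v
    rw [hv.apply_eq_smul, norm_smul, Complex.norm_real] at hle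
    exact (le_abs_self μ).trans (le_of_mul_le_mul_right hle (norm_pos_iff.2 hv.2))
  have key := ((euclideanRegular G).squareSum_isSymmetric
    (inner_euclideanRegular G)).re_inner_pow_succ_le hC n (EuclideanSpace.single 1 1)
  rw [re_inner_squareSum_euclideanRegular_pow, re_inner_squareSum_euclideanRegular_pow] at key
  rw [mul_comm]
  exact_mod_cast key
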